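/- Let d ≥ 2 be an integer and let ρ₁, ρ₂ be probability vectors on Fin d with strictly positive entries. Define the Chernoff information ξ(ρ₁,ρ₂) = -log( min over s ∈ [0,1] of ∑ i, (ρ₁ i)^s · (ρ₂ i)^{1-s} ), and set Δ = H(ρ₁) - H(ρ₂) and L = (log(d-1))² + 4. Then ξ(ρ₁,ρ₂) ≥ |Δ|²/(2L) - |Δ|³/(3L²). -/

import Mathlib

open scoped ENNReal BigOperators

noncomputable section

/-- Binary entropy (natural log), with Lean's convention `Real.log 0 = 0`. -/
def binEntropy' (x : ℝ) : ℝ := -(x * Real.log x) - (1 - x) * Real.log (1 - x)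

/-- Binary relative entropy, valued in `[0,∞]`. -/
def binRelEntropy (x y : ℝ) : ℝ≥0∞ :=
  if (y = 0 ∧ 0 < x) ∨ (y = 1 ∧ x < 1) then ⊤
  else ENNReal.ofReal (x * Real.log (x / y) + (1 - x) * Real.log ((1 - x) / (1 - y)))

/-- `M(Δ,d)`: infimum of binary relative entropies under the entropy-difference constraint. -/
def Mfun (Δ : ℝ) (d : ℕ) : ℝ≥0∞ :=
  sInf {m : ℝ≥0∞ | ∃ s r : ℝ, s ∈ Set.Icc (0:ℝ) (((d:ℝ) - 1) / d) ∧
    r ∈ Set.Icc (0:ℝ) (((d:ℝ) - 1) / d) ∧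
    binEntropy' s - binEntropy' r + (s - r) * Real.log ((d:ℝ) - 1) = Δ ∧
    m = binRelEntropy s r}

/-- Shannon entropy of a probability vector on `Fin d` (natural log). -/
def shEntropy {d : ℕ} (p : Fin d → ℝ) : ℝ := ∑ i, -(p i * Real.log (p i))

/-- Relative entropy between probability vectors on `Fin d`, valued in `[0,∞]`. -/
def relEntropy {d : ℕ} (p q : Fin d → ℝ) : ℝ≥0∞ :=
  if ∀ i, q i = 0 → p i = 0
  then ENNReal.ofReal (∑ i, p i * Real.log (p i / q i))
  else ⊤

/-- `N(d) = sup_{0<r<1/2} r(1-r) (log(((1-r)/r)(d-1)))²`. -/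
def Nfun (d : ℕ) : ℝ :=
  sSup {v : ℝ | ∃ r : ℝ, 0 < r ∧ r < 1/2 ∧
    v = r * (1 - r) * (Real.log ((1 - r) / r * ((d:ℝ) - 1)))^2}

/-- A function with nonnegative second derivative on an open convex set that vanishes to first order
at a point is nonnegative. -/
lemma nonneg_of_second_deriv_nonneg {S : Set ℝ} (hS : Convex ℝ S) (hSo : IsOpen S)
    {f df ddf : ℝ → ℝ} (hf : ∀ x ∈ S, HasDerivAt f (df x) x)
    (hdf : ∀ x ∈ S, HasDerivAt df (ddf x) x) (hddf : ∀ x ∈ S, 0 ≤ ddf x)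
    {a : ℝ} (ha : a ∈ S) (hfa : f a = 0) (hdfa : df a = 0) {x : ℝ} (hx : x ∈ S) : 0 ≤ f x := by
  have hderiv : ∀ x ∈ S, HasDerivAt (deriv f) (ddf x) x := fun x hx =>
    (hdf x hx).congr_of_eventuallyEq
      ((hSo.eventually_mem hx).mono fun y hy => (hf y hy).deriv)
  have hconv : ConvexOn ℝ S f := by
    refine convexOn_of_deriv2_nonneg' hS
      (fun x hx => (hf x hx).differentiableAt.differentiableWithinAt)
      (fun x hx => (hderiv x hx).differentiableAt.differentiableWithinAt) fun x hx => ?_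
    simpa [(hderiv x hx).deriv] using hddf x hx
  have hd := hf a ha
  rw [hdfa] at hd
  rcases lt_trichotomy a x with h | rfl | h
  · have := hconv.le_slope_of_hasDerivAt ha hx h hd
    rw [slope_def_field, hfa, sub_zero] at this
    have := mul_nonneg this (sub_pos.2 h).le
    rwa [div_mul_cancel₀ _ (sub_pos.2 h).ne'] at this
  · exact hfa.ge
  · have := hconv.slope_le_of_hasDerivAt hx ha h hd
    rw [slope_def_field, hfa, zero_sub, div_nonpos_iff] at this
    rcases this with ⟨_, hneg⟩ | ⟨hneg, _⟩ <;> linarith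

lemma cubic_le_exp_neg (t : ℝ) : t ^ 2 / 2 - t ^ 3 / 6 ≤ Real.exp (-t) - 1 + t := by
  have h1 : ∀ x ∈ Set.univ, HasDerivAt
      (fun t : ℝ => Real.exp (-t) - 1 + t - t ^ 2 / 2 + t ^ 3 / 6)
      (-Real.exp (-x) + 1 - x + x ^ 2 / 2) x := by
    intro x _
    have := (((((hasDerivAt_id x).neg.exp).sub_const 1).add (hasDerivAt_id x)).sub
      ((hasDerivAt_pow 2 x).div_const 2)).add ((hasDerivAt_pow 3 x).div_const 6)
    refine this.congr_deriv ?_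
    simp
    ring
  have h2 : ∀ x ∈ Set.univ, HasDerivAt
      (fun x : ℝ => -Real.exp (-x) + 1 - x + x ^ 2 / 2) (Real.exp (-x) - 1 + x) x := by
    intro x _
    have := ((((hasDerivAt_id x).neg.exp).neg.add_const 1).sub (hasDerivAt_id x)).add
      ((hasDerivAt_pow 2 x).div_const 2)
    refine this.congr_deriv ?_
    simp
  have := nonneg_of_second_deriv_nonneg convex_univ isOpen_univ h1 h2
    (fun x _ => by linarith [Real.add_one_le_exp (-x)]) (Set.mem_univ 0) (by simp) (by simp)
    (Set.mem_univ t)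
  linarith

lemma exp_sub_one_sub_ge_of_le_abs {t y : ℝ} (hy : 0 ≤ y) (hyt : y ≤ |t|) :
    Real.exp (-y) - 1 + y ≤ Real.exp t - 1 - t := by
  have h1 : Real.exp (-y) + y ≤ Real.exp (-|t|) + |t| := by
    have e : Real.exp (-|t|) = Real.exp (-y) * Real.exp (-(|t| - y)) := by
      rw [← Real.exp_add]; ring_nf
    have e1 := Real.add_one_le_exp (-(|t| - y))
    have e2 : Real.exp (-y) ≤ 1 := Real.exp_le_one_iff.2 (by linarith)
    have e3 := Real.exp_pos (-y)
    nlinarith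
  have h2 : Real.exp (-|t|) + |t| ≤ Real.exp t - t := by
    rcases le_total 0 t with h | h
    · have := Real.self_le_sinh_iff.2 h
      rw [Real.sinh_eq] at this
      rw [abs_of_nonneg h]
      linarith
    · rw [abs_of_nonpos h, neg_neg]
      linarith
  linarith

lemma two_add_sq_le_exp_add_exp_neg (z : ℝ) :
    2 + z ^ 2 ≤ Real.exp z + Real.exp (-z) := by
  have h1 : ∀ x ∈ Set.univ, HasDerivAt
      (fun z : ℝ => Real.exp z + Real.exp (-z) - 2 - z ^ 2)
      (Real.exp x - Real.exp (-x) - 2 * x) x := by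
    intro x _
    have := ((((Real.hasDerivAt_exp x).add ((hasDerivAt_id x).neg.exp)).sub_const 2).sub
      (hasDerivAt_pow 2 x))
    refine this.congr_deriv ?_
    simp
    ring
  have h2 : ∀ x ∈ Set.univ, HasDerivAt
      (fun x : ℝ => Real.exp x - Real.exp (-x) - 2 * x)
      (Real.exp x + Real.exp (-x) - 2) x := by
    intro x _
    have := (((Real.hasDerivAt_exp x).sub ((hasDerivAt_id x).neg.exp)).sub
      ((hasDerivAt_id x).const_mul 2))
    refine this.congr_deriv ?_
    simp
  have := nonneg_of_second_deriv_nonneg convex_univ isOpen_univ h1 h2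
    (fun x _ => by linarith [Real.add_one_le_exp (-x), Real.add_one_le_exp x])
    (Set.mem_univ 0) (by norm_num) (by simp) (Set.mem_univ z)
  linarith

/-- Bound on the variance of a log-likelihood taking two values with probabilities `P` and `Q`. -/
lemma mul_mul_log_div_add_sq_le {P Q a l : ℝ} (hP : 0 < P) (hQ : 0 < Q) (hPQ : P + Q = 1)
    (ha : a ^ 2 ≤ l ^ 2) : P * Q * (Real.log (P / Q) + a) ^ 2 ≤ l ^ 2 / 4 + 1 := by
  set z := Real.log (P / Q) with hz
  have hcs : (z + a) ^ 2 ≤ (l ^ 2 + 4) * (1 + z ^ 2 / 4) := by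
    nlinarith [sq_nonneg (a * z - 4), sq_nonneg z, mul_nonneg (sub_nonneg.2 ha) (sq_nonneg z)]
  have hexp := two_add_sq_le_exp_add_exp_neg z
  rw [hz, Real.exp_neg, Real.exp_log (div_pos hP hQ), ← hz] at hexp
  have hPQz : P * Q * (4 + z ^ 2) ≤ 1 := by
    have h := mul_le_mul_of_nonneg_left hexp (mul_pos hP hQ).le
    have e : P * Q * (P / Q + (P / Q)⁻¹) = P ^ 2 + Q ^ 2 := by field_simp
    have e2 : (P + Q) ^ 2 = 1 := by rw [hPQ]; norm_num
    nlinarith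
  calc P * Q * (z + a) ^ 2 ≤ P * Q * ((l ^ 2 + 4) * (1 + z ^ 2 / 4)) :=
        mul_le_mul_of_nonneg_left hcs (mul_pos hP hQ).le
    _ = (P * Q * (4 + z ^ 2)) * ((l ^ 2 + 4) / 4) := by ring
    _ ≤ 1 * ((l ^ 2 + 4) / 4) := by gcongr
    _ = _ := by ring

/-- Variance of the information content `-log p` under `p`. -/
def varentropy {ι : Type*} [Fintype ι] (p : ι → ℝ) : ℝ :=
  ∑ i, p i * Real.log (p i) ^ 2 - (∑ i, p i * Real.log (p i)) ^ 2

lemma continuousOn_varentropy {ι : Type*} [Fintype ι] :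
    ContinuousOn (varentropy : (ι → ℝ) → ℝ) (stdSimplex ℝ ι) := by
  have h : ∀ p ∈ stdSimplex ℝ ι, varentropy p =
      ∑ i, 4 * (√(p i) * Real.log √(p i)) ^ 2 - (∑ i, p i * Real.log (p i)) ^ 2 := by
    intro p hp
    unfold varentropy
    congr 1
    refine Finset.sum_congr rfl fun i _ => ?_
    rw [Real.log_sqrt (hp.1 i), mul_pow, Real.sq_sqrt (hp.1 i)]
    ring
  refine ContinuousOn.congr (Continuous.continuousOn ?_) h
  have h1 : ∀ i : ι, Continuous fun p : ι → ℝ => √(p i) * Real.log √(p i) := fun i =>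
    Real.continuous_mul_log.comp (Real.continuous_sqrt.comp (continuous_apply i))
  have h2 : ∀ i : ι, Continuous fun p : ι → ℝ => p i * Real.log (p i) := fun i =>
    Real.continuous_mul_log.comp (continuous_apply i)
  fun_prop

lemma hasDerivAt_varentropy_line {ι : Type*} [Fintype ι] {p c : ι → ℝ}
    (hpc : ∀ k, p k = 0 → c k = 0) :
    HasDerivAt (fun t : ℝ => varentropy fun k => p k + t * c k)
      (∑ k, c k * (Real.log (p k) ^ 2 + 2 * Real.log (p k)) -
        2 * (∑ k, p k * Real.log (p k)) * ∑ k, c k * (Real.log (p k) + 1)) 0 := by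
  have hlin : ∀ k, HasDerivAt (fun t : ℝ => p k + t * c k) (c k) 0 := fun k => by
    simpa using ((hasDerivAt_id (0 : ℝ)).mul_const (c k)).const_add (p k)
  have h1 : ∀ k, HasDerivAt (fun t : ℝ => (p k + t * c k) * Real.log (p k + t * c k))
      (c k * (Real.log (p k) + 1)) 0 := fun k => by
    by_cases hk : p k = 0
    · simpa [hk, hpc k hk] using hasDerivAt_const (0 : ℝ) (0 : ℝ)
    · refine ((hlin k).mul ((hlin k).log (by simpa using hk))).congr_deriv ?_
      simp only [zero_mul, add_zero]
      field_simp
  have h2 : ∀ k, HasDerivAt (fun t : ℝ => (p k + t * c k) * Real.log (p k + t * c k) ^ 2)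
      (c k * (Real.log (p k) ^ 2 + 2 * Real.log (p k))) 0 := fun k => by
    by_cases hk : p k = 0
    · simpa [hk, hpc k hk] using hasDerivAt_const (0 : ℝ) (0 : ℝ)
    · refine ((hlin k).mul (((hlin k).log (by simpa using hk)).pow 2)).congr_deriv ?_
      simp only [zero_mul, add_zero, Pi.pow_apply]
      field_simp
      simp only [Nat.cast_ofNat, Nat.add_one_sub_one, pow_one]
      ring
  refine ((HasDerivAt.fun_sum fun k _ => h2 k).sub
    ((HasDerivAt.fun_sum fun k _ => h1 k).pow 2)).congr_deriv ?_
  simp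

/-- First-order condition at a maximizer of the varentropy. -/
lemma log_add_log_eq_of_isMaxOn_varentropy {ι : Type*} [Fintype ι] {p : ι → ℝ}
    (hp : p ∈ stdSimplex ℝ ι) (hmax : IsMaxOn varentropy (stdSimplex ℝ ι) p)
    {i j : ι} (hi : p i ≠ 0) (hj : p j ≠ 0) (hij : p i ≠ p j) :
    Real.log (p i) + Real.log (p j) = 2 * (∑ k, p k * Real.log (p k)) - 2 := by
  classical
  have hne : i ≠ j := fun h => hij (h ▸ rfl)
  have hi0 : 0 < p i := lt_of_le_of_ne (hp.1 i) hi.symm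
  have hj0 : 0 < p j := lt_of_le_of_ne (hp.1 j) hj.symm
  set c : ι → ℝ := Pi.single i 1 - Pi.single j 1 with hc
  have hci : c i = 1 := by simp [hc, hne]
  have hcj : c j = -1 := by simp [hc, hne.symm]
  have hck : ∀ k, k ≠ i → k ≠ j → c k = 0 := fun k h1 h2 => by simp [hc, h1, h2]
  have hsum : ∀ f : ι → ℝ, ∑ k, c k * f k = f i - f j := fun f => by
    simp [hc, sub_mul, Finset.sum_sub_distrib, Pi.single_apply]
  have hder := hasDerivAt_varentropy_line (p := p) (c := c) fun k hk =>
    hck k (fun h => hi (h ▸ hk)) (fun h => hj (h ▸ hk))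
  have hloc : IsLocalMax (fun t : ℝ => varentropy fun k => p k + t * c k) 0 := by
    have hev : ∀ᶠ t : ℝ in nhds 0, |t| < min (p i) (p j) := by
      have : Filter.Tendsto (fun t : ℝ => |t|) (nhds 0) (nhds 0) := by
        simpa using (continuous_abs.tendsto (0 : ℝ))
      exact this.eventually_lt_const (lt_min hi0 hj0)
    filter_upwards [hev] with t ht
    have ht1 := abs_lt.1 (ht.trans_le (min_le_left _ _))
    have ht2 := abs_lt.1 (ht.trans_le (min_le_right _ _))
    have hmem : (fun k => p k + t * c k) ∈ stdSimplex ℝ ι := by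
      refine ⟨fun k => ?_, ?_⟩
      · by_cases h1 : k = i
        · subst h1; simp only [hci]; linarith
        by_cases h2 : k = j
        · subst h2; simp only [hcj]; linarith
        simpa [hck k h1 h2] using hp.1 k
      · have := hsum fun _ => t
        simp only [mul_comm _ t, sub_self] at this
        rw [Finset.sum_add_distrib, this, hp.2, add_zero]
    simpa using hmax hmem
  have h0 := hloc.hasDerivAt_eq_zero hder
  rw [hsum, hsum] at h0
  have hlog : Real.log (p i) - Real.log (p j) ≠ 0 := fun h =>
    hij (Real.log_injOn_pos hi0 hj0 (sub_eq_zero.1 h))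
  refine mul_left_cancel₀ hlog ?_
  linear_combination h0

lemma varentropy_eq_zero_of_const_on_support {ι : Type*} [Fintype ι] {p : ι → ℝ}
    (hp : ∑ k, p k = 1) {x : ℝ} (h : ∀ k, p k ≠ 0 → p k = x) : varentropy p = 0 := by
  have key : ∀ g : ℝ → ℝ, ∑ k, p k * g (p k) = g x := fun g => by
    rw [← one_mul (g x), ← hp, Finset.sum_mul]
    refine Finset.sum_congr rfl fun k _ => ?_
    by_cases hk : p k = 0
    · simp [hk]
    · rw [h k hk]
  rw [varentropy, key fun y => Real.log y ^ 2, key Real.log, sub_self]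

lemma sq_log_div_le {k n d : ℕ} (hk : 1 ≤ k) (hn : 1 ≤ n) (hkn : k + n ≤ d) :
    Real.log ((n : ℝ) / k) ^ 2 ≤ Real.log ((d : ℝ) - 1) ^ 2 := by
  have aux : ∀ {k n : ℕ}, 1 ≤ k → 1 ≤ n → k + n ≤ d →
      Real.log ((n : ℝ) / k) ≤ Real.log ((d : ℝ) - 1) := by
    intro k n hk hn hkn
    have hk' : (1 : ℝ) ≤ k := by exact_mod_cast hk
    have hn' : (1 : ℝ) ≤ n := by exact_mod_cast hn
    have hkn' : (k : ℝ) + n ≤ d := by exact_mod_cast hkn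
    refine Real.log_le_log (by positivity) ((div_le_self (by linarith) hk').trans (by linarith))
  refine sq_le_sq' ?_ (aux hk hn hkn)
  have := aux hn hk (by omega : n + k ≤ d)
  rw [← inv_div, Real.log_inv] at this
  linarith

lemma varentropy_le_of_two_values {ι : Type*} [Fintype ι] {p : ι → ℝ}
    (hp : p ∈ stdSimplex ℝ ι) {i j : ι} (hi : p i ≠ 0) (hj : p j ≠ 0) (hij : p i ≠ p j)
    (h : ∀ k, p k ≠ 0 → p k = p i ∨ p k = p j) :
    varentropy p ≤ Real.log ((Fintype.card ι : ℝ) - 1) ^ 2 / 4 + 1 := by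
  classical
  set x := p i with hx
  set y := p j with hy
  have hx0 : 0 < x := lt_of_le_of_ne (hp.1 i) hi.symm
  have hy0 : 0 < y := lt_of_le_of_ne (hp.1 j) hj.symm
  set A : Finset ι := {k | p k = x} with hA
  set B : Finset ι := {k | p k = y} with hB
  have hA1 : 1 ≤ A.card := Finset.card_pos.2 ⟨i, by simp [hA, hx]⟩
  have hB1 : 1 ≤ B.card := Finset.card_pos.2 ⟨j, by simp [hB, hy]⟩
  have hAB : A.card + B.card ≤ Fintype.card ι := by
    rw [← Finset.card_union_of_disjoint]
    · exact Finset.card_le_univ _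
    · rw [Finset.disjoint_filter]
      exact fun k _ h1 h2 => hij (h1.symm.trans h2)
  have key : ∀ g : ℝ → ℝ, ∑ k, p k * g (p k) = A.card * x * g x + B.card * y * g y := fun g => by
    have : ∀ k, p k * g (p k) =
        (if p k = x then x * g x else 0) + (if p k = y then y * g y else 0) := fun k => by
      by_cases hk : p k = 0
      · simp [hk, hi.symm, hj.symm]
      · rcases h k hk with hk | hk
        · simp [hk, hij]
        · simp [hk, hij.symm]
    simp_rw [this, Finset.sum_add_distrib, ← Finset.sum_filter, Finset.sum_const, nsmul_eq_mul]
    ring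
  have hsum : A.card * x + B.card * y = 1 := by
    have := key fun _ => 1
    simpa [hp.2] using this.symm
  have hA1' : (0 : ℝ) < A.card := by exact_mod_cast hA1
  have hB1' : (0 : ℝ) < B.card := by exact_mod_cast hB1
  have hmain := mul_mul_log_div_add_sq_le (mul_pos hA1' hx0) (mul_pos hB1' hy0) hsum
    (sq_log_div_le hA1 hB1 hAB)
  have hlog : Real.log (A.card * x / (B.card * y)) + Real.log ((B.card : ℝ) / A.card) =
      Real.log x - Real.log y := by
    rw [Real.log_div (by positivity) (by positivity), Real.log_mul (by positivity) hi,
      Real.log_mul (by positivity) hj, Real.log_div (by positivity) (by positivity)]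
    ring
  rw [hlog] at hmain
  refine le_of_eq_of_le ?_ hmain
  rw [varentropy, key fun y => Real.log y ^ 2, key Real.log]
  linear_combination (A.card * x * Real.log x ^ 2 + B.card * y * Real.log y ^ 2) * (-hsum)

/-- The varentropy on `d` points is at most `(log (d - 1))² / 4 + 1`. -/
theorem varentropy_le {ι : Type*} [Fintype ι] {p : ι → ℝ} (hp : p ∈ stdSimplex ℝ ι) :
    varentropy p ≤ Real.log ((Fintype.card ι : ℝ) - 1) ^ 2 / 4 + 1 := by
  obtain ⟨q, hq, hmax⟩ :=
    (isCompact_stdSimplex ℝ ι).exists_isMaxOn ⟨p, hp⟩ continuousOn_varentropy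
  refine (hmax hp).trans ?_
  obtain ⟨i, hi⟩ : ∃ i, q i ≠ 0 := by
    by_contra! h
    simpa [h] using hq.2
  by_cases hconst : ∀ k, q k ≠ 0 → q k = q i
  · rw [varentropy_eq_zero_of_const_on_support hq.2 hconst]
    positivity
  push Not at hconst
  obtain ⟨j, hj, hji⟩ := hconst
  refine varentropy_le_of_two_values hq hi hj hji.symm fun k hk => ?_
  by_contra! hki
  have h1 := log_add_log_eq_of_isMaxOn_varentropy hq hmax hi hj hji.symm
  have h2 := log_add_log_eq_of_isMaxOn_varentropy hq hmax hi hk hki.1.symm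
  exact hki.2 (Real.log_injOn_pos (lt_of_le_of_ne (hq.1 k) hk.symm)
    (lt_of_le_of_ne (hq.1 j) hj.symm) (by linarith))

lemma hasDerivAt_sum_rpow_mul {ι : Type*} [Fintype ι] {ρ : ι → ℝ} (hρ : ∀ i, 0 < ρ i)
    (w : ι → ℝ) (γ : ℝ) :
    HasDerivAt (fun γ : ℝ => ∑ i, ρ i ^ γ * w i) (∑ i, ρ i ^ γ * (Real.log (ρ i) * w i)) γ := by
  refine (HasDerivAt.fun_sum fun i _ =>
    ((hasDerivAt_id γ).const_rpow (hρ i)).mul_const (w i)).congr_deriv ?_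
  exact Finset.sum_congr rfl fun i _ => by simp; ring

/-- The variance of `log ρ` under the escort distribution `ρ ^ γ / ∑ ρ ^ γ`. -/
lemma escort_variance_le {ι : Type*} [Fintype ι] [Nonempty ι] {ρ : ι → ℝ} (hρ : ∀ i, 0 < ρ i)
    {N : ℝ} (hN : ∀ p ∈ stdSimplex ℝ ι, varentropy p ≤ N) {γ : ℝ} (hγ : 0 < γ) :
    (∑ i, ρ i ^ γ * Real.log (ρ i) ^ 2) / (∑ i, ρ i ^ γ) -
      ((∑ i, ρ i ^ γ * Real.log (ρ i)) / ∑ i, ρ i ^ γ) ^ 2 ≤ N / γ ^ 2 := by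
  set Z := ∑ i, ρ i ^ γ with hZ
  have hpos : ∀ i, 0 < ρ i ^ γ := fun i => Real.rpow_pos_of_pos (hρ i) γ
  have hZ0 : 0 < Z := Finset.sum_pos (fun i _ => hpos i) Finset.univ_nonempty
  have hsum : ∑ i, ρ i ^ γ / Z = 1 := by rw [← Finset.sum_div, div_self hZ0.ne']
  have hlog : ∀ i, Real.log (ρ i ^ γ / Z) = γ * Real.log (ρ i) - Real.log Z := fun i => by
    rw [Real.log_div (hpos i).ne' hZ0.ne', Real.log_rpow (hρ i)]
  have hv := hN (fun i => ρ i ^ γ / Z) ⟨fun i => (div_pos (hpos i) hZ0).le, hsum⟩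
  have e1 : ∑ i, ρ i ^ γ / Z * Real.log (ρ i ^ γ / Z) =
      γ * ((∑ i, ρ i ^ γ * Real.log (ρ i)) / Z) - Real.log Z := by
    conv_rhs => rw [← mul_one (Real.log Z), ← hsum, Finset.sum_div, Finset.mul_sum,
      Finset.mul_sum, ← Finset.sum_sub_distrib]
    exact Finset.sum_congr rfl fun i _ => by rw [hlog]; ring
  have e2 : ∑ i, ρ i ^ γ / Z * Real.log (ρ i ^ γ / Z) ^ 2 =
      γ ^ 2 * ((∑ i, ρ i ^ γ * Real.log (ρ i) ^ 2) / Z) -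
        2 * γ * Real.log Z * ((∑ i, ρ i ^ γ * Real.log (ρ i)) / Z) + Real.log Z ^ 2 := by
    conv_rhs => rw [← mul_one (Real.log Z ^ 2), ← hsum, Finset.sum_div, Finset.sum_div,
      Finset.mul_sum, Finset.mul_sum, Finset.mul_sum, ← Finset.sum_sub_distrib,
      ← Finset.sum_add_distrib]
    exact Finset.sum_congr rfl fun i _ => by rw [hlog]; ring
  rw [varentropy, e1, e2] at hv
  rw [le_div_iff₀ (by positivity)]
  linarith

/-- Second-order bound on the log-partition function `γ ↦ log ∑ ρ ^ γ` around `γ = 1`. -/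
lemma log_sum_rpow_le {ι : Type*} [Fintype ι] [Nonempty ι] {ρ : ι → ℝ} (hρ : ∀ i, 0 < ρ i)
    (hρ1 : ∑ i, ρ i = 1) {N : ℝ} (hN : ∀ p ∈ stdSimplex ℝ ι, varentropy p ≤ N)
    {γ : ℝ} (hγ : 0 < γ) :
    Real.log (∑ i, ρ i ^ γ) ≤
      (γ - 1) * (∑ i, ρ i * Real.log (ρ i)) + N * (γ - 1 - Real.log γ) := by
  set E := ∑ i, ρ i * Real.log (ρ i) with hE
  have hZ0 : ∀ γ : ℝ, ∑ i, ρ i ^ γ ≠ 0 := fun γ =>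
    (Finset.sum_pos (fun i _ => Real.rpow_pos_of_pos (hρ i) γ) Finset.univ_nonempty).ne'
  have hZ : ∀ γ : ℝ, HasDerivAt (fun γ : ℝ => ∑ i, ρ i ^ γ) (∑ i, ρ i ^ γ * Real.log (ρ i)) γ :=
    fun γ => by simpa using hasDerivAt_sum_rpow_mul hρ (fun _ => 1) γ
  have hZ' : ∀ γ : ℝ, HasDerivAt (fun γ : ℝ => ∑ i, ρ i ^ γ * Real.log (ρ i))
      (∑ i, ρ i ^ γ * Real.log (ρ i) ^ 2) γ :=
    fun γ => by simpa [sq] using hasDerivAt_sum_rpow_mul hρ (fun i => Real.log (ρ i)) γ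
  have h1 : ∀ x ∈ Set.Ioi (0 : ℝ), HasDerivAt
      (fun γ => (γ - 1) * E + N * (γ - 1 - Real.log γ) - Real.log (∑ i, ρ i ^ γ))
      (E + N * (1 - x⁻¹) - (∑ i, ρ i ^ x * Real.log (ρ i)) / ∑ i, ρ i ^ x) x := by
    intro x hx
    refine (((((hasDerivAt_id x).sub_const 1).mul_const E).add
      ((((hasDerivAt_id x).sub_const 1).sub
        (Real.hasDerivAt_log (ne_of_gt hx))).const_mul N)).sub
      ((hZ x).log (hZ0 x))).congr_deriv ?_
    ring
  have h2 : ∀ x ∈ Set.Ioi (0 : ℝ), HasDerivAt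
      (fun x => E + N * (1 - x⁻¹) - (∑ i, ρ i ^ x * Real.log (ρ i)) / ∑ i, ρ i ^ x)
      (N / x ^ 2 - ((∑ i, ρ i ^ x * Real.log (ρ i) ^ 2) / (∑ i, ρ i ^ x) -
        ((∑ i, ρ i ^ x * Real.log (ρ i)) / ∑ i, ρ i ^ x) ^ 2)) x := by
    intro x hx
    refine (((((hasDerivAt_inv (ne_of_gt hx)).const_sub 1).const_mul N).const_add E).sub
      ((hZ' x).div (hZ x) (hZ0 x))).congr_deriv ?_
    have := hZ0 x
    have : x ≠ 0 := ne_of_gt hx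
    field_simp
  have := nonneg_of_second_deriv_nonneg (convex_Ioi 0) isOpen_Ioi h1 h2
    (fun x hx => sub_nonneg.2 (escort_variance_le hρ hN hx)) (Set.mem_Ioi.2 one_pos)
    (by simp [hρ1]) (by simp [hρ1, hE]) (Set.mem_Ioi.2 hγ)
  linarith

/-- Gibbs variational inequality. -/
lemma sum_mul_sub_log_le_log_sum {ι : Type*} [Fintype ι] [Nonempty ι] {σ w : ι → ℝ}
    (hσ : ∀ i, 0 < σ i) (hσ1 : ∑ i, σ i = 1) (hw : ∀ i, 0 < w i) :
    ∑ i, σ i * (Real.log (w i) - Real.log (σ i)) ≤ Real.log (∑ i, w i) := by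
  have hW : 0 < ∑ i, w i := Finset.sum_pos (fun i _ => hw i) Finset.univ_nonempty
  have h : ∀ i, σ i * (Real.log (w i) - Real.log (σ i)) ≤
      w i / (∑ j, w j) - σ i + σ i * Real.log (∑ j, w j) := fun i => by
    have := Real.log_le_sub_one_of_pos (div_pos (div_pos (hw i) hW) (hσ i))
    rw [Real.log_div (div_pos (hw i) hW).ne' (hσ i).ne', Real.log_div (hw i).ne' hW.ne'] at this
    have := mul_le_mul_of_nonneg_left this (hσ i).le
    rw [mul_sub (σ i) (_ / _), mul_div_cancel₀ _ (hσ i).ne'] at this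
    linarith
  refine (Finset.sum_le_sum fun i _ => h i).trans_eq ?_
  rw [Finset.sum_add_distrib, Finset.sum_sub_distrib, ← Finset.sum_div, ← Finset.sum_mul, hσ1,
    div_self hW.ne']
  ring

/-- Lower bound on the relative entropy by the entropy difference, in terms of a uniform bound on
the varentropy. -/
theorem relative_entropy_ge {ι : Type*} [Fintype ι] [Nonempty ι] {σ ρ : ι → ℝ}
    (hσ : ∀ i, 0 < σ i) (hσ1 : ∑ i, σ i = 1) (hρ : ∀ i, 0 < ρ i) (hρ1 : ∑ i, ρ i = 1)
    {N : ℝ} (hN0 : 0 < N) (hN : ∀ p ∈ stdSimplex ℝ ι, varentropy p ≤ N) {x : ℝ}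
    (hx : x = ∑ i, ρ i * Real.log (ρ i) - ∑ i, σ i * Real.log (σ i)) :
    N * (Real.exp (x / N) - 1 - x / N) ≤ ∑ i, σ i * (Real.log (σ i) - Real.log (ρ i)) := by
  set u := Real.exp (x / N) with hu
  have hu0 : 0 < u := Real.exp_pos _
  have hK := log_sum_rpow_le hρ hρ1 hN (inv_pos.2 hu0)
  have hG := sum_mul_sub_log_le_log_sum hσ hσ1
    fun i => Real.rpow_pos_of_pos (hρ i) u⁻¹
  simp_rw [Real.log_rpow (hρ _), mul_sub, Finset.sum_sub_distrib, mul_left_comm (σ _) u⁻¹,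
    ← Finset.mul_sum] at hG
  rw [Real.log_inv, hu, Real.log_exp, ← hu] at hK
  have h := mul_le_mul_of_nonneg_left (hG.trans hK) hu0.le
  simp_rw [mul_sub, Finset.sum_sub_distrib]
  generalize ∑ i, σ i * Real.log (ρ i) = S at *
  generalize ∑ i, σ i * Real.log (σ i) = A at *
  generalize ∑ i, ρ i * Real.log (ρ i) = B at *
  have e1 : u * (u⁻¹ * S - A) = S - u * A := by field_simp
  have e2 : u * ((u⁻¹ - 1) * B + N * (u⁻¹ - 1 - -(x / N))) =
      (1 - u) * B + (N - u * N + u * x) := by field_simp; ring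
  have e3 : N * (x / N) = x := by field_simp
  have e4 : u * x = u * (B - A) := congrArg (u * ·) hx
  rw [e1, e2] at h
  rw [e3]
  linarith

/-- The tilted vector `ρ₁ ^ c ρ₂ ^ (1 - c)`, normalized, is equidistant in relative entropy to `ρ₁`
and `ρ₂` at a critical point `c`, at distance the Chernoff information. -/
lemma exists_chernoff_point {ι : Type*} [Fintype ι] [Nonempty ι] {ρ₁ ρ₂ : ι → ℝ}
    (h1 : ∀ i, 0 < ρ₁ i) (h2 : ∀ i, 0 < ρ₂ i) (hs1 : ∑ i, ρ₁ i = 1) (hs2 : ∑ i, ρ₂ i = 1) :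
    ∃ c ∈ Set.Ioo (0 : ℝ) 1, ∃ τ : ι → ℝ, (∀ i, 0 < τ i) ∧ ∑ i, τ i = 1 ∧
      ∑ i, τ i * (Real.log (τ i) - Real.log (ρ₁ i)) =
        -Real.log (∑ i, ρ₁ i ^ c * ρ₂ i ^ (1 - c)) ∧
      ∑ i, τ i * (Real.log (τ i) - Real.log (ρ₂ i)) =
        -Real.log (∑ i, ρ₁ i ^ c * ρ₂ i ^ (1 - c)) := by
  have hder : ∀ c : ℝ, HasDerivAt (fun c : ℝ => ∑ i, ρ₁ i ^ c * ρ₂ i ^ (1 - c))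
      (∑ i, ρ₁ i ^ c * ρ₂ i ^ (1 - c) * (Real.log (ρ₁ i) - Real.log (ρ₂ i))) c := fun c => by
    refine (HasDerivAt.fun_sum fun i _ => ((hasDerivAt_id c).const_rpow (h1 i)).mul
      (((hasDerivAt_id c).const_sub 1).const_rpow (h2 i))).congr_deriv ?_
    exact Finset.sum_congr rfl fun i _ => by simp; ring
  obtain ⟨c, hc, hc0⟩ := exists_hasDerivAt_eq_zero (zero_lt_one' ℝ)
    (fun x _ => (hder x).continuousAt.continuousWithinAt) (by simp [hs1, hs2])
    (fun x _ => hder x)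
  set g := ∑ i, ρ₁ i ^ c * ρ₂ i ^ (1 - c) with hg
  have hpos : ∀ i, 0 < ρ₁ i ^ c * ρ₂ i ^ (1 - c) := fun i =>
    mul_pos (Real.rpow_pos_of_pos (h1 i) _) (Real.rpow_pos_of_pos (h2 i) _)
  have hg0 : 0 < g := Finset.sum_pos (fun i _ => hpos i) Finset.univ_nonempty
  have hτ1 : ∑ i, ρ₁ i ^ c * ρ₂ i ^ (1 - c) / g = 1 := by
    rw [← Finset.sum_div, div_self hg0.ne']
  have hlog : ∀ i, Real.log (ρ₁ i ^ c * ρ₂ i ^ (1 - c) / g) =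
      c * Real.log (ρ₁ i) + (1 - c) * Real.log (ρ₂ i) - Real.log g := fun i => by
    rw [Real.log_div (hpos i).ne' hg0.ne', Real.log_mul (Real.rpow_pos_of_pos (h1 i) _).ne'
      (Real.rpow_pos_of_pos (h2 i) _).ne', Real.log_rpow (h1 i), Real.log_rpow (h2 i)]
  have key : ∀ a : ℝ, ∑ i, ρ₁ i ^ c * ρ₂ i ^ (1 - c) / g *
      (a * (Real.log (ρ₁ i) - Real.log (ρ₂ i)) - Real.log g) = -Real.log g := fun a => by
    have : ∀ i, ρ₁ i ^ c * ρ₂ i ^ (1 - c) / g *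
        (a * (Real.log (ρ₁ i) - Real.log (ρ₂ i)) - Real.log g) =
        a / g * (ρ₁ i ^ c * ρ₂ i ^ (1 - c) * (Real.log (ρ₁ i) - Real.log (ρ₂ i))) -
          ρ₁ i ^ c * ρ₂ i ^ (1 - c) / g * Real.log g := fun i => by ring
    simp_rw [this, Finset.sum_sub_distrib, ← Finset.mul_sum, ← Finset.sum_mul, hc0, hτ1]
    ring
  refine ⟨c, hc, fun i => ρ₁ i ^ c * ρ₂ i ^ (1 - c) / g, fun i => div_pos (hpos i) hg0, hτ1,
    ?_, ?_⟩
  · rw [← key (c - 1)]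
    exact Finset.sum_congr rfl fun i _ => by rw [hlog]; ring
  · rw [← key c]
    exact Finset.sum_congr rfl fun i _ => by rw [hlog]; ring

lemma mul_le_rpow_mul_rpow {a b s : ℝ} (ha : 0 < a) (ha1 : a ≤ 1) (hb : 0 < b) (hb1 : b ≤ 1)
    (hs : s ∈ Set.Icc (0 : ℝ) 1) : a * b ≤ a ^ s * b ^ (1 - s) := by
  have h1 := Real.rpow_le_rpow_of_exponent_ge ha ha1 hs.2
  have h2 := Real.rpow_le_rpow_of_exponent_ge hb hb1 (show 1 - s ≤ 1 by linarith [hs.1])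
  rw [Real.rpow_one] at h1 h2
  exact mul_le_mul h1 h2 hb.le (Real.rpow_nonneg ha.le _)

lemma neg_log_le_neg_log_sInf {ι : Type*} [Fintype ι] [Nonempty ι] {ρ₁ ρ₂ : ι → ℝ}
    (h1 : ∀ i, 0 < ρ₁ i) (h2 : ∀ i, 0 < ρ₂ i) (hs1 : ∑ i, ρ₁ i = 1) (hs2 : ∑ i, ρ₂ i = 1)
    {c : ℝ} (hc : c ∈ Set.Icc (0 : ℝ) 1) :
    -Real.log (∑ i, ρ₁ i ^ c * ρ₂ i ^ (1 - c)) ≤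
      -Real.log (sInf {v : ℝ | ∃ s ∈ Set.Icc (0 : ℝ) 1,
        v = ∑ i, (ρ₁ i) ^ s * (ρ₂ i) ^ (1 - s)}) := by
  have hle : ∀ {ρ : ι → ℝ}, (∀ i, 0 < ρ i) → ∑ i, ρ i = 1 → ∀ i, ρ i ≤ 1 := fun h hs i =>
    hs ▸ Finset.single_le_sum (fun j _ => (h j).le) (Finset.mem_univ i)
  have hlb : ∑ i, ρ₁ i * ρ₂ i ∈ lowerBounds {v : ℝ | ∃ s ∈ Set.Icc (0 : ℝ) 1,
      v = ∑ i, (ρ₁ i) ^ s * (ρ₂ i) ^ (1 - s)} := by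
    rintro v ⟨s, hs, rfl⟩
    exact Finset.sum_le_sum fun i _ =>
      mul_le_rpow_mul_rpow (h1 i) (hle h1 hs1 i) (h2 i) (hle h2 hs2 i) hs
  have hpos : 0 < ∑ i, ρ₁ i * ρ₂ i :=
    Finset.sum_pos (fun i _ => mul_pos (h1 i) (h2 i)) Finset.univ_nonempty
  exact neg_le_neg (Real.log_le_log (hpos.trans_le (le_csInf ⟨_, c, hc, rfl⟩ hlb))
    (csInf_le ⟨_, hlb⟩ ⟨c, hc, rfl⟩))

/-- lower bound on the Chernoff information via the entropy difference. -/
theorem chernoff_information_lower_bound (d : ℕ) (hd : 2 ≤ d) (ρ₁ ρ₂ : Fin d → ℝ)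
    (h1 : ∀ i, 0 < ρ₁ i) (h2 : ∀ i, 0 < ρ₂ i)
    (hs1 : ∑ i, ρ₁ i = 1) (hs2 : ∑ i, ρ₂ i = 1) :
    -Real.log (sInf {v : ℝ | ∃ s ∈ Set.Icc (0:ℝ) 1, v = ∑ i, (ρ₁ i) ^ s * (ρ₂ i) ^ (1 - s)}) ≥
      |shEntropy ρ₁ - shEntropy ρ₂|^2 / (2 * ((Real.log ((d:ℝ) - 1))^2 + 4)) -
        |shEntropy ρ₁ - shEntropy ρ₂|^3 / (3 * ((Real.log ((d:ℝ) - 1))^2 + 4)^2) := by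
  have : Nonempty (Fin d) := ⟨⟨0, by omega⟩⟩
  obtain ⟨c, hc, τ, hτ, hτ1, hD1, hD2⟩ := exists_chernoff_point h1 h2 hs1 hs2
  refine ge_iff_le.2 (le_trans ?_
    (neg_log_le_neg_log_sInf h1 h2 hs1 hs2 (Set.Ioo_subset_Icc_self hc)))
  set g := ∑ i, ρ₁ i ^ c * ρ₂ i ^ (1 - c)
  set l := Real.log ((d : ℝ) - 1)
  set Δ := shEntropy ρ₁ - shEntropy ρ₂ with hΔ
  have hN0 : 0 < l ^ 2 / 4 + 1 := by positivity
  have hN : ∀ p ∈ stdSimplex ℝ (Fin d), varentropy p ≤ l ^ 2 / 4 + 1 := fun p hp => by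
    simpa using varentropy_le hp
  set N := l ^ 2 / 4 + 1 with hNdef
  have hbound : ∀ ρ : Fin d → ℝ, (∀ i, 0 < ρ i) → ∑ i, ρ i = 1 →
      ∑ i, τ i * (Real.log (τ i) - Real.log (ρ i)) = -Real.log g →
      |Δ| / 2 ≤ |shEntropy τ - shEntropy ρ| →
      |Δ| ^ 2 / (2 * (l ^ 2 + 4)) - |Δ| ^ 3 / (3 * (l ^ 2 + 4) ^ 2) ≤ -Real.log g := by
    intro ρ hρ hρ1 hD hle
    rw [← hD]
    refine le_trans ?_ (relative_entropy_ge hτ hτ1 hρ hρ1 hN0 hN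
      (x := shEntropy τ - shEntropy ρ) (by simp [shEntropy]; ring))
    have hy : |Δ| / 2 / N ≤ |(shEntropy τ - shEntropy ρ) / N| := by
      rw [abs_div, abs_of_pos hN0]
      gcongr
    refine le_trans ?_ (mul_le_mul_of_nonneg_left
      ((cubic_le_exp_neg _).trans (exp_sub_one_sub_ge_of_le_abs (by positivity) hy)) hN0.le)
    have hL : l ^ 2 + 4 = 4 * N := by rw [hNdef]; ring
    rw [hL]
    refine le_of_eq ?_
    field_simp
    ring
  have hsplit : |Δ| ≤ |shEntropy τ - shEntropy ρ₁| + |shEntropy τ - shEntropy ρ₂| := by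
    rw [hΔ, abs_sub_comm (shEntropy τ) (shEntropy ρ₁)]
    exact abs_sub_le _ _ _
  rcases le_total |shEntropy τ - shEntropy ρ₁| |shEntropy τ - shEntropy ρ₂| with h | h
  · exact hbound ρ₂ h2 hs2 hD2 (by linarith)
  · exact hbound ρ₁ h1 hs1 hD1 (by linarith)

end
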